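/- arXiv:2312.03362 — 5 statements merged into one kernel-verified Lean document; each statement's English description precedes it below -/
import Mathlib

section
/- Let ξ be a height function on [1,n] and Q_ξ the associated iced quiver. In the principal part of Q_ξ (the full subquiver on the mutable vertices 1,…,n obtained by deleting the frozen vertices 1′,…,n′,1″,…,n″ and all arrows incident to them), a vertex j ∈ {1,…,n} is a sink or a source if and only if j = 1 or j = j_⋄. -/
open scoped Classical

/-- A height function on `[1,n]`. -/
def HeightFunction (n : ℤ) (ξ : ℤ → ℤ) : Prop :=
  (∀ i : ℤ, 2 ≤ i → i ≤ n → |ξ i - ξ (i - 1)| = 1) ∧ ξ 0 = ξ 2 ∧ ξ (n + 1) = ξ (n - 1)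

/-- `i_⋄`: the minimal `l ∈ [i, n−2]` with `ξ(l) = ξ(l+2)`, and `n−1` if no such `l` exists;
by convention `n_⋄ = n` (the case `i = n−1` is covered by the empty-set default `n−1`). -/
noncomputable def diamond (n : ℤ) (ξ : ℤ → ℤ) (i : ℤ) : ℤ :=
  if i = n then n
  else if ({l : ℤ | i ≤ l ∧ l ≤ n - 2 ∧ ξ l = ξ (l + 2)} : Set ℤ).Nonempty then
    sInf {l : ℤ | i ≤ l ∧ l ≤ n - 2 ∧ ξ l = ξ (l + 2)}
  else n - 1

/-- `j_•`: `0` for `j ≤ 1_⋄`, and otherwise the maximal `l ∈ [1_⋄, j)` with `l = l_⋄`. -/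
noncomputable def bullet (n : ℤ) (ξ : ℤ → ℤ) (j : ℤ) : ℤ :=
  if j ≤ diamond n ξ 1 then 0
  else sSup {l : ℤ | diamond n ξ 1 ≤ l ∧ l < j ∧ l = diamond n ξ l}

/-- `d_j`: `1` if `j = j_⋄` and `0` otherwise (with the convention `d_l = 0` for `l ≤ 0`). -/
noncomputable def dd (n : ℤ) (ξ : ℤ → ℤ) (j : ℤ) : ℤ :=
  if 1 ≤ j ∧ j = diamond n ξ j then 1 else 0

/-- Vertices of the iced quiver `Q_ξ`: `pr i = i′` (frozen), `mut i = i` (mutable for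
`1 ≤ i ≤ n`), `dpr i = i″` (frozen). -/
inductive V : Type
  | pr : ℤ → V
  | mut : ℤ → V
  | dpr : ℤ → V
  deriving DecidableEq

/-- The number of arrows `u → v` in the iced quiver `Q_ξ`. -/
noncomputable def arrows (n : ℤ) (ξ : ℤ → ℤ) : V → V → ℤ
  | V.mut j, V.mut k =>
      if k = j + 1 ∧ 1 ≤ j ∧ j ≤ n - 1 ∧
          ((ξ (j + 1) = ξ j + 1 ∧ dd n ξ j = 1) ∨ (ξ (j + 1) = ξ j - 1 ∧ dd n ξ j = 0)) then 1
      else if j = k + 1 ∧ 1 ≤ k ∧ k ≤ n - 1 ∧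
          ((ξ (k + 1) = ξ k + 1 ∧ dd n ξ k = 0) ∨ (ξ (k + 1) = ξ k - 1 ∧ dd n ξ k = 1)) then 1
      else 0
  | V.pr i, V.mut j =>
      if (i = j ∧ ((1 ≤ j ∧ j ≤ n - 1 ∧ ξ (j + 1) = ξ j + 1) ∨ (j = n ∧ ξ (n - 1) = ξ n + 1)))
          ∨ (i = j + 1 ∧ 1 ≤ j ∧ j ≤ n - 1 ∧ ξ (j + 1) = ξ j - 1 ∧ dd n ξ j = 0) then 1
      else 0
  | V.mut j, V.pr i =>
      if (i = j ∧ ((1 ≤ j ∧ j ≤ n - 1 ∧ ξ (j + 1) = ξ j - 1) ∨ (j = n ∧ ξ (n - 1) = ξ n - 1)))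
          ∨ (i = j + 1 ∧ 1 ≤ j ∧ j ≤ n - 1 ∧ ξ (j + 1) = ξ j + 1 ∧ dd n ξ j = 0) then 1
      else 0
  | V.dpr i, V.mut j =>
      if (i = j ∧ ((1 ≤ j ∧ j ≤ n - 1 ∧ ξ (j + 1) = ξ j + 1) ∨ (j = n ∧ ξ (n - 1) = ξ n + 1)))
          ∨ (i = j + 1 ∧ 1 ≤ j ∧ j ≤ n - 1 ∧ ξ (j + 1) = ξ j - 1 ∧ dd n ξ j = 0) then 1
      else 0
  | V.mut j, V.dpr i =>
      if (i = j ∧ ((1 ≤ j ∧ j ≤ n - 1 ∧ ξ (j + 1) = ξ j - 1) ∨ (j = n ∧ ξ (n - 1) = ξ n - 1)))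
          ∨ (i = j + 1 ∧ 1 ≤ j ∧ j ≤ n - 1 ∧ ξ (j + 1) = ξ j + 1 ∧ dd n ξ j = 0) then 1
      else 0
  | _, _ => 0

/-- The skew-symmetric matrix `B_ξ` encoding `Q_ξ`:
`B_ξ(u,v) = (arrows u → v) − (arrows v → u)`. -/
noncomputable def Bxi (n : ℤ) (ξ : ℤ → ℤ) (u v : V) : ℤ := arrows n ξ u v - arrows n ξ v u

/-- Frozen vertices of `Q_ξ`. -/
def V.frozen : V → Bool
  | V.mut _ => false
  | _ => true

/-- Matrix mutation at the vertex `k`: `μ_k(B)(u,v) = −B(u,v)` if `u = k` or `v = k`, and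
`B(u,v) + (|B(u,k)| B(k,v) + B(u,k) |B(k,v)|)/2` otherwise, with every entry between two
frozen vertices set to `0`. -/
noncomputable def mutateB (k : V) (B : V → V → ℤ) : V → V → ℤ := fun u v =>
  if u.frozen ∧ v.frozen then 0
  else if u = k ∨ v = k then -B u v
  else B u v + (|B u k| * B k v + B u k * |B k v|) / 2

theorem diamond_fix (n : ℤ) (ξ : ℤ → ℤ) (j : ℤ) (h2 : j ≤ n) :
    j = diamond n ξ j ↔ (j = n ∨ j = n - 1 ∨ (j ≤ n - 2 ∧ ξ j = ξ (j + 2))) := by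
  have bdd : BddBelow {l : ℤ | j ≤ l ∧ l ≤ n - 2 ∧ ξ l = ξ (l + 2)} := ⟨j, fun l hl => hl.1⟩
  unfold diamond
  split_ifs with h h'
  · simp [h]
  · have hm := Int.csInf_mem h' bdd
    constructor
    · intro e
      rw [← e] at hm
      exact Or.inr (Or.inr hm.2)
    · rintro (e | e | e)
      · exact absurd e h
      · obtain ⟨l, hl1, hl2, _⟩ := h'
        omega
      · exact le_antisymm hm.1 (csInf_le bdd ⟨le_refl _, e⟩)
  · constructor
    · intro e
      exact Or.inr (Or.inl e)
    · rintro (e | e | e)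
      · exact absurd e h
      · exact e
      · exact absurd ⟨j, le_refl _, e⟩ h'

theorem dd_or (n : ℤ) (ξ : ℤ → ℤ) (j : ℤ) (h1 : 1 ≤ j) (h2 : j ≤ n) :
    (dd n ξ j = 1 ∧ (j = n ∨ j = n - 1 ∨ (j ≤ n - 2 ∧ ξ j = ξ (j + 2)))) ∨
    (dd n ξ j = 0 ∧ ¬ (j = n ∨ j = n - 1 ∨ (j ≤ n - 2 ∧ ξ j = ξ (j + 2)))) := by
  rw [← diamond_fix n ξ j h2]
  unfold dd
  by_cases h : j = diamond n ξ j
  · left; rw [if_pos ⟨h1, h⟩]; exact ⟨rfl, h⟩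
  · right; rw [if_neg (fun h' => h h'.2)]; exact ⟨rfl, h⟩

theorem arrow_zero_iff (n : ℤ) (ξ : ℤ → ℤ) (j k : ℤ) :
    arrows n ξ (V.mut j) (V.mut k) = 0 ↔
      ¬ (k = j + 1 ∧ 1 ≤ j ∧ j ≤ n - 1 ∧
          ((ξ (j + 1) = ξ j + 1 ∧ dd n ξ j = 1) ∨ (ξ (j + 1) = ξ j - 1 ∧ dd n ξ j = 0))) ∧
      ¬ (j = k + 1 ∧ 1 ≤ k ∧ k ≤ n - 1 ∧
          ((ξ (k + 1) = ξ k + 1 ∧ dd n ξ k = 0) ∨ (ξ (k + 1) = ξ k - 1 ∧ dd n ξ k = 1))) := by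
  simp only [arrows]
  split_ifs with h h'
  · exact ⟨fun e => absurd e one_ne_zero, fun e => absurd h e.1⟩
  · exact ⟨fun e => absurd e one_ne_zero, fun e => absurd h' e.2⟩
  · exact ⟨fun _ => ⟨h, h'⟩, fun _ => rfl⟩

/-- Outgoing arrows only involve the two neighbours. -/
theorem out_iff (n : ℤ) (ξ : ℤ → ℤ) (j : ℤ) :
    (∀ k : ℤ, arrows n ξ (V.mut j) (V.mut k) = 0) ↔
      ¬ (1 ≤ j ∧ j ≤ n - 1 ∧
          ((ξ (j + 1) = ξ j + 1 ∧ dd n ξ j = 1) ∨ (ξ (j + 1) = ξ j - 1 ∧ dd n ξ j = 0))) ∧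
      ¬ (1 ≤ j - 1 ∧ j - 1 ≤ n - 1 ∧
          ((ξ j = ξ (j - 1) + 1 ∧ dd n ξ (j - 1) = 0) ∨
            (ξ j = ξ (j - 1) - 1 ∧ dd n ξ (j - 1) = 1))) := by
  simp only [arrow_zero_iff]
  constructor
  · intro h
    refine ⟨fun h' => (h (j + 1)).1 ⟨rfl, h'⟩, fun h' => (h (j - 1)).2 ⟨by ring, ?_⟩⟩
    rw [sub_add_cancel]; exact h'
  · rintro ⟨ha, hb⟩ k
    refine ⟨fun h' => ha h'.2, ?_⟩
    rintro ⟨rfl, h'⟩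
    rw [add_sub_cancel_right] at hb
    exact hb h'

theorem in_iff (n : ℤ) (ξ : ℤ → ℤ) (j : ℤ) :
    (∀ k : ℤ, arrows n ξ (V.mut k) (V.mut j) = 0) ↔
      ¬ (1 ≤ j ∧ j ≤ n - 1 ∧
          ((ξ (j + 1) = ξ j + 1 ∧ dd n ξ j = 0) ∨ (ξ (j + 1) = ξ j - 1 ∧ dd n ξ j = 1))) ∧
      ¬ (1 ≤ j - 1 ∧ j - 1 ≤ n - 1 ∧
          ((ξ j = ξ (j - 1) + 1 ∧ dd n ξ (j - 1) = 1) ∨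
            (ξ j = ξ (j - 1) - 1 ∧ dd n ξ (j - 1) = 0))) := by
  simp only [arrow_zero_iff]
  constructor
  · intro h
    refine ⟨fun h' => (h (j + 1)).2 ⟨rfl, h'⟩, fun h' => (h (j - 1)).1 ⟨by ring, ?_⟩⟩
    rw [sub_add_cancel]; exact h'
  · rintro ⟨ha, hb⟩ k
    refine ⟨?_, fun h' => ha h'.2⟩
    rintro ⟨rfl, h'⟩
    rw [add_sub_cancel_right] at hb
    exact hb h'

/-- In the principal part of `Q_ξ` (the full subquiver on the mutable
vertices `1, …, n`), a vertex `j ∈ [1,n]` is a sink (no outgoing arrows) or a source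
(no incoming arrows) if and only if `j = 1` or `j = j_⋄`. -/
theorem principal_sink_or_source_iff (n : ℤ) (hn : 2 ≤ n) (ξ : ℤ → ℤ)
    (hξ : HeightFunction n ξ) (j : ℤ) (h1 : 1 ≤ j) (h2 : j ≤ n) :
    ((∀ k : ℤ, arrows n ξ (V.mut j) (V.mut k) = 0) ∨
        (∀ k : ℤ, arrows n ξ (V.mut k) (V.mut j) = 0)) ↔
      (j = 1 ∨ j = diamond n ξ j) := by
  rw [out_iff, in_iff, diamond_fix n ξ j h2]
  have hstep : ∀ i : ℤ, 2 ≤ i → i ≤ n → (ξ i = ξ (i - 1) + 1 ∨ ξ i = ξ (i - 1) - 1) := by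
    intro i hi hi'
    have := hξ.1 i hi hi'
    rcases (abs_eq (by norm_num)).1 this with h | h <;> omega
  have dj := dd_or n ξ j h1 h2
  by_cases hj1 : j = 1
  · have hs := hstep (j + 1) (by omega) (by omega)
    rw [add_sub_cancel_right] at hs
    omega
  have hs := hstep j (by omega) h2
  have dj' := dd_or n ξ (j - 1) (by omega) (by omega)
  rw [show j - 1 + 2 = j + 1 by ring] at dj'
  by_cases hjn : j = n
  · omega
  have hs' := hstep (j + 1) (by omega) (by omega)
  rw [add_sub_cancel_right] at hs'
  omega
end

section
/- Let ξ be a height function on [1,n]. Then in the field F, for every 1 ≤ i ≤ n: x_i · x[α_{i,i}] = f′_i f″_i x_{i+1}^{1−d_i} + x_{i−1} (f′_{i+1} f″_{i+1})^{1−d_i} x_{i+1}^{d_i}. -/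
open scoped Classical

/-- The ambient field: the fraction field of the polynomial ring over `ℚ` whose
indeterminates are indexed by the vertices of `Q_ξ`; the `3n` indeterminates attached to
the vertices `1′,…,n′,1,…,n,1″,…,n″` generate the field `F` of the paper. -/
abbrev F : Type := FractionRing (MvPolynomial V ℚ)

/-- The indeterminate attached to a vertex. -/
noncomputable def gen (v : V) : F := algebraMap (MvPolynomial V ℚ) F (MvPolynomial.X v)

/-- The initial extended cluster: the indeterminate at each vertex with label in `[1,n]`,
and `1` otherwise (the conventions `x_0 = x_{n+1} = f′_{n+1} = f″_{n+1} = 1`). -/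
noncomputable def initZ (n : ℤ) : V → F
  | V.pr l => if 1 ≤ l ∧ l ≤ n then gen (V.pr l) else 1
  | V.mut l => if 1 ≤ l ∧ l ≤ n then gen (V.mut l) else 1
  | V.dpr l => if 1 ≤ l ∧ l ≤ n then gen (V.dpr l) else 1

/-- Seed mutation at the vertex `k`: the exchange relation
`z_k ↦ (∏_{B(u,k)>0} z_u^{B(u,k)} + ∏_{B(u,k)<0} z_u^{−B(u,k)})/z_k` together with matrix
mutation. -/
noncomputable def mutateSeed (k : V) (S : (V → F) × (V → V → ℤ)) : (V → F) × (V → V → ℤ) :=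
  ⟨fun v =>
    if v = k then
      ((finprod fun u => S.1 u ^ (S.2 u k).toNat) +
        (finprod fun u => S.1 u ^ (-(S.2 u k)).toNat)) / S.1 k
    else S.1 v,
   mutateB k S.2⟩

/-- The seed obtained from the initial seed `(initZ n, B_ξ)` by mutating successively at
the mutable vertices `i, i+1, …, i+m−1`. -/
noncomputable def seedFrom (n : ℤ) (ξ : ℤ → ℤ) (i : ℤ) (m : ℕ) : (V → F) × (V → V → ℤ) :=
  ((List.range m).map fun t => i + (t : ℤ)).foldl (fun S k => mutateSeed (V.mut k) S)
    ⟨initZ n, Bxi n ξ⟩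

/-- The cluster variable `x[α_{i,j}]`: the element attached to the vertex `j` after
mutating successively at `i, i+1, …, j`. -/
noncomputable def xAlpha (n : ℤ) (ξ : ℤ → ℤ) (i j : ℤ) : F :=
  (seedFrom n ξ i (j + 1 - i).toNat).1 (V.mut j)

/-- `x_l` (with `x_0 = x_{n+1} = 1`). -/
noncomputable def xv (n : ℤ) (l : ℤ) : F := initZ n (V.mut l)

/-- `f′_l` (with `f′_{n+1} = 1`). -/
noncomputable def fp (n : ℤ) (l : ℤ) : F := initZ n (V.pr l)

/-- `f″_l` (with `f″_{n+1} = 1`). -/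
noncomputable def fpp (n : ℤ) (l : ℤ) : F := initZ n (V.dpr l)

/-- The Kronecker delta. -/
def kron (a b : ℤ) : ℤ := if a = b then 1 else 0

lemma dd_n (n : ℤ) (hn : 2 ≤ n) (ξ : ℤ → ℤ) : dd n ξ n = 1 := by
  have : 1 ≤ n := by omega
  simp [dd, diamond, this]

lemma dd_n1 (n : ℤ) (hn : 2 ≤ n) (ξ : ℤ → ℤ) : dd n ξ (n - 1) = 1 := by
  have h : ¬ ({l : ℤ | n - 1 ≤ l ∧ l ≤ n - 2 ∧ ξ l = ξ (l + 2)} : Set ℤ).Nonempty := by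
    rintro ⟨l, a, b, _⟩
    omega
  have h1 : 1 ≤ n - 1 := by omega
  have h2 : n - 1 ≠ n := by omega
  unfold dd diamond
  rw [if_neg h2, if_neg h]
  simp [h1]

lemma dd_mid (n : ℤ) (ξ : ℤ → ℤ) (j : ℤ) (h1 : 1 ≤ j) (h2 : j ≤ n - 2) :
    dd n ξ j = if ξ j = ξ (j + 2) then 1 else 0 := by
  have h3 : j ≠ n := by omega
  have hb : BddBelow {l : ℤ | j ≤ l ∧ l ≤ n - 2 ∧ ξ l = ξ (l + 2)} := ⟨j, fun l h => h.1⟩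
  unfold dd diamond
  rw [if_neg h3]
  by_cases hx : ξ j = ξ (j + 2)
  · have hm : j ∈ {l : ℤ | j ≤ l ∧ l ≤ n - 2 ∧ ξ l = ξ (l + 2)} := ⟨le_rfl, h2, hx⟩
    have hne : ({l : ℤ | j ≤ l ∧ l ≤ n - 2 ∧ ξ l = ξ (l + 2)} : Set ℤ).Nonempty := ⟨j, hm⟩
    rw [if_pos hne, if_pos hx, if_pos]
    exact ⟨h1, le_antisymm (Int.csInf_mem hne hb).1 (csInf_le hb hm)⟩
  · rw [if_neg hx, if_neg]
    rintro ⟨_, h⟩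
    split_ifs at h with hne
    · have := Int.csInf_mem hne hb
      rw [← h] at this
      exact hx this.2.2
    · omega

/-- Normalised column of the exchange matrix. -/
noncomputable def colB (n i d : ℤ) : V → ℤ
  | V.pr k => if k = i then 1 else if k = i + 1 then d - 1 else 0
  | V.dpr k => if k = i then 1 else if k = i + 1 then d - 1 else 0
  | V.mut k => if k = i - 1 then (if i = 1 then 0 else -1)
      else if k = i + 1 then (if i = n then 0 else 1 - 2 * d) else 0

lemma dd_01 (n : ℤ) (ξ : ℤ → ℤ) (j : ℤ) : dd n ξ j = 0 ∨ dd n ξ j = 1 := by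
  unfold dd
  split_ifs <;> simp

lemma step_pm (n : ℤ) (ξ : ℤ → ℤ) (hξ : HeightFunction n ξ) (j : ℤ) (h1 : 1 ≤ j)
    (h2 : j + 1 ≤ n) : ξ (j + 1) = ξ j + 1 ∨ ξ (j + 1) = ξ j - 1 := by
  have h := hξ.1 (j + 1) (by omega) h2
  rw [add_sub_cancel_right] at h
  rcases (abs_eq (by norm_num)).1 h with h | h <;> omega

lemma col_eq (n : ℤ) (hn : 2 ≤ n) (ξ : ℤ → ℤ)
    (hξ : HeightFunction n ξ) (i : ℤ) (h1 : 1 ≤ i) (h2 : i ≤ n) :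
    (∀ u, Bxi n ξ u (V.mut i) = colB n i (dd n ξ i) u) ∨
    (∀ u, Bxi n ξ u (V.mut i) = - colB n i (dd n ξ i) u) := by
  have hd := dd_01 n ξ i
  have hp := step_pm n ξ hξ i h1
  have hq : 2 ≤ i → ξ i = ξ (i - 1) + 1 ∨ ξ i = ξ (i - 1) - 1 := by
    intro h
    have := step_pm n ξ hξ (i - 1) (by omega) (by omega)
    simpa using this
  have hdn := dd_n n hn ξ
  have hdm := dd_n1 n hn ξ
  have hm : 2 ≤ i → i ≤ n - 1 → dd n ξ (i - 1) = if ξ (i - 1) = ξ (i + 1) then 1 else 0 := by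
    intro a b
    have := dd_mid n ξ (i - 1) (by omega) (by omega)
    rwa [show i - 1 + 2 = i + 1 by ring] at this
  have key : ∀ s : ℤ, (s = 1 ∧ ((i ≤ n - 1 ∧ ξ (i + 1) = ξ i + 1) ∨ (i = n ∧ ξ (n - 1) = ξ n + 1)))
      ∨ (s = -1 ∧ ((i ≤ n - 1 ∧ ξ (i + 1) = ξ i - 1) ∨ (i = n ∧ ξ (n - 1) = ξ n - 1))) →
      ∀ u, Bxi n ξ u (V.mut i) = s * colB n i (dd n ξ i) u := by
    intro s hs u
    have e1 : i - 1 + 1 = i := by ring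
    rcases u with k | k | k
    · simp only [Bxi, arrows, colB]
      grind
    · simp only [Bxi, arrows, colB]
      by_cases hk : k = i - 1
      · subst hk
        rw [e1]
        grind
      · by_cases hk : k = i + 1
        · subst hk
          grind
        · grind
    · simp only [Bxi, arrows, colB]
      grind
  by_cases hi : i = n
  · subst hi
    rcases hq hn with h | h
    · right
      intro u
      rw [key (-1) (Or.inr ⟨rfl, Or.inr ⟨rfl, by omega⟩⟩) u]; ring
    · left
      intro u
      rw [key 1 (Or.inl ⟨rfl, Or.inr ⟨rfl, by omega⟩⟩) u]; ring
  · rcases hp (by omega) with h | h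
    · left
      intro u
      rw [key 1 (Or.inl ⟨rfl, Or.inl ⟨by omega, h⟩⟩) u]; ring
    · right
      intro u
      rw [key (-1) (Or.inr ⟨rfl, Or.inl ⟨by omega, h⟩⟩) u]; ring

lemma finprod_col (n i d : ℤ) (z : V → F) (g : ℤ → ℕ) (hg : g 0 = 0) :
    (finprod fun u => z u ^ g (colB n i d u)) =
      z (V.pr i) ^ g 1 * z (V.dpr i) ^ g 1 * z (V.pr (i + 1)) ^ g (d - 1) *
       z (V.dpr (i + 1)) ^ g (d - 1) * z (V.mut (i - 1)) ^ g (if i = 1 then 0 else -1) *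
       z (V.mut (i + 1)) ^ g (if i = n then 0 else 1 - 2 * d) := by
  have e1 : i + 1 ≠ i - 1 := by omega
  have e2 : i - 1 ≠ i + 1 := by omega
  rw [finprod_eq_prod_of_mulSupport_subset (s := {V.pr i, V.dpr i, V.pr (i + 1), V.dpr (i + 1),
    V.mut (i - 1), V.mut (i + 1)})]
  · rw [Finset.prod_insert (by simp), Finset.prod_insert (by simp), Finset.prod_insert (by simp),
      Finset.prod_insert (by simp), Finset.prod_insert (by simp [e2]), Finset.prod_singleton]
    simp only [colB, e1, if_true, if_false, show i + 1 ≠ i by omega]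
    ring
  · intro u hu
    by_contra hc
    apply hu
    have : colB n i d u = 0 := by
      rcases u with k | k | k <;> simp at hc <;> simp [colB, hc]
    simp [this, hg]

lemma initZ_ne (n : ℤ) (v : V) : initZ n v ≠ 0 := by
  have hg : ∀ v, gen v ≠ 0 := by
    intro v h
    have := (IsFractionRing.injective (MvPolynomial V ℚ) F) (h.trans (map_zero _).symm)
    exact MvPolynomial.X_ne_zero v this
  rcases v with k | k | k <;> simp only [initZ] <;> split_ifs <;> simp [hg]

lemma main_sum (n i d : ℤ) (h1 : 1 ≤ i) (hd : d = 0 ∨ d = 1) (hin : i = n → d = 1) :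
    (finprod fun u => initZ n u ^ (colB n i d u).toNat) +
      (finprod fun u => initZ n u ^ (-colB n i d u).toNat) =
      fp n i * fpp n i * xv n (i + 1) ^ (1 - d) +
        xv n (i - 1) * (fp n (i + 1) * fpp n (i + 1)) ^ (1 - d) *
          xv n (i + 1) ^ d := by
  rw [finprod_col n i d (initZ n) Int.toNat rfl,
    finprod_col n i d (initZ n) (fun a => (-a).toNat) rfl]
  have a0 : i = 1 → xv n (i - 1) = 1 := by
    rintro rfl
    simp [xv, initZ]
  have a1 : i = n → xv n (i + 1) = 1 := by
    rintro rfl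
    simp [xv, initZ]
  change fp n i ^ _ * fpp n i ^ _ * fp n (i + 1) ^ _ * fpp n (i + 1) ^ _ * xv n (i - 1) ^ _ *
    xv n (i + 1) ^ _ + fp n i ^ _ * fpp n i ^ _ * fp n (i + 1) ^ _ * fpp n (i + 1) ^ _ *
    xv n (i - 1) ^ _ * xv n (i + 1) ^ _ = _
  generalize xv n (i - 1) = x at *
  generalize xv n (i + 1) = y at *
  rcases hd with rfl | rfl
  · have : i ≠ n := fun h => by simpa using hin h
    by_cases hi : i = 1
    · simp [a0 hi, this, show (1:ℤ) ≠ n from fun h => this (hi.trans h), hi]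
      try grind
    · simp [this, hi]
      try ring
  · by_cases hi : i = 1 <;> by_cases hj : i = n
    · simp [a0 hi, a1 hj]
    · simp [a0 hi, hj]
    · simp [hi, a1 hj]
    · simp [hi, hj]

/-- For every `1 ≤ i ≤ n`:
`x_i ⬝ x[α_{i,i}] = f′_i f″_i x_{i+1}^{1−d_i} + x_{i−1} (f′_{i+1} f″_{i+1})^{1−d_i} x_{i+1}^{d_i}`. -/
theorem exchange_relation_first_step (n : ℤ) (hn : 2 ≤ n) (ξ : ℤ → ℤ)
    (hξ : HeightFunction n ξ) (i : ℤ) (h1 : 1 ≤ i) (h2 : i ≤ n) :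
    xv n i * xAlpha n ξ i i =
      fp n i * fpp n i * xv n (i + 1) ^ (1 - dd n ξ i) +
        xv n (i - 1) * (fp n (i + 1) * fpp n (i + 1)) ^ (1 - dd n ξ i) *
          xv n (i + 1) ^ (dd n ξ i) := by
  have hz : xv n i ≠ 0 := initZ_ne n _
  have hx : xAlpha n ξ i i = ((finprod fun u => initZ n u ^ (Bxi n ξ u (V.mut i)).toNat) +
      (finprod fun u => initZ n u ^ (-(Bxi n ξ u (V.mut i))).toNat)) / xv n i := by
    have : (i + 1 - i).toNat = 1 := by
      rw [add_sub_cancel_left]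
      rfl
    simp [xAlpha, seedFrom, mutateSeed, this, xv]
  rw [hx, mul_div_cancel₀ _ hz, ← main_sum n i (dd n ξ i) h1 (dd_01 n ξ i)
    (fun h => by rw [h]; exact dd_n n hn ξ)]
  rcases col_eq n hn ξ hξ i h1 h2 with h | h
  · simp only [h]
  · simp only [h, neg_neg]
    rw [add_comm]
end

section
/- Let ξ be a height function on [1,n], let r ≥ 1, and let 1 ≤ i < j ≤ n. If i_⋄ < j − 1 and j − 1 ≠ (j−1)_⋄, then in 𝒫: (ω(i,j))_r = (ω(i, j_•+1))_r · (Y_{j, ξ(j+1)})_r. -/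
open scoped Classical

/-- The free abelian group `𝒫` on the symbols `Y_{i,a}`, written multiplicatively. -/
abbrev P : Type := Multiplicative ((ℤ × ℤ) →₀ ℤ)

/-- The generator `Y_{i,a}` of `𝒫`. -/
noncomputable def Y (i a : ℤ) : P := Multiplicative.ofAdd (Finsupp.single (i, a) 1)

/-- `(Y_{i,a})_r := ∏_{t=0}^{r-1} Y_{i, a+2t}`. -/
noncomputable def Ypow (i a : ℤ) (r : ℕ) : P := ∏ t ∈ Finset.range r, Y i (a + 2 * (t : ℤ))

/-- `(ω(i,j))_r`, where `ω(i,j) = Y_{i₁,a₁} ⋯ Y_{i_k,a_k}` with `i = i₁ < i₂ < ⋯ < i_k = j`,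
the middle indices being the `l` with `i < l < j` and `ξ(l−1) = ξ(l+1)`, and
`a₁ = 2ξ(i) − ξ(i+1)`, `a_l = 2ξ(i_l) − ξ(i_l − 1)` for `l ≥ 2`. -/
noncomputable def omegaR (ξ : ℤ → ℤ) (i j : ℤ) (r : ℕ) : P :=
  Ypow i (2 * ξ i - ξ (i + 1)) r *
    (∏ l ∈ (Finset.Ioo i j).filter (fun l => ξ (l - 1) = ξ (l + 1)),
      Ypow l (2 * ξ l - ξ (l - 1)) r) *
    Ypow j (2 * ξ j - ξ (j - 1)) r

theorem diamond_mem_aux (n : ℤ) (ξ : ℤ → ℤ) (i : ℤ) (h : diamond n ξ i < n - 1) :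
    i ≤ diamond n ξ i ∧ diamond n ξ i ≤ n - 2 ∧
      ξ (diamond n ξ i) = ξ (diamond n ξ i + 2) := by
  by_cases h1 : i = n
  · simp [diamond, h1] at h
    omega
  by_cases h2 : ({l : ℤ | i ≤ l ∧ l ≤ n - 2 ∧ ξ l = ξ (l + 2)} : Set ℤ).Nonempty
  · have h3 := Int.csInf_mem h2 ⟨i, fun x hx => hx.1⟩
    have h4 : diamond n ξ i = sInf {l : ℤ | i ≤ l ∧ l ≤ n - 2 ∧ ξ l = ξ (l + 2)} := by
      unfold diamond
      rw [if_neg h1, if_pos h2]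
    rw [← h4] at h3
    exact h3
  · have h4 : diamond n ξ i = n - 1 := by
      unfold diamond
      rw [if_neg h1, if_neg h2]
    omega

theorem diamond_le_aux (n : ℤ) (ξ : ℤ → ℤ) (i l : ℤ) (h1 : i ≤ l) (h2 : l ≤ n - 2)
    (h3 : ξ l = ξ (l + 2)) : diamond n ξ i ≤ l := by
  have hm : l ∈ ({l : ℤ | i ≤ l ∧ l ≤ n - 2 ∧ ξ l = ξ (l + 2)} : Set ℤ) := ⟨h1, h2, h3⟩
  unfold diamond
  rw [if_neg (by omega), if_pos ⟨l, hm⟩]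
  exact csInf_le ⟨i, fun x hx => hx.1⟩ hm

theorem diamond_fix_aux (n : ℤ) (ξ : ℤ → ℤ) (l : ℤ) (h2 : l ≤ n - 2) :
    l = diamond n ξ l ↔ ξ l = ξ (l + 2) := by
  constructor
  · intro h
    have := (diamond_mem_aux n ξ l (by omega)).2.2
    rwa [← h] at this
  · intro h
    have h3 := diamond_le_aux n ξ l l le_rfl h2 h
    have := (diamond_mem_aux n ξ l (by omega)).1
    omega

/-- If `i_⋄ < j − 1` and `j − 1 ≠ (j−1)_⋄`, then
`(ω(i,j))_r = (ω(i, j_•+1))_r ⬝ (Y_{j, ξ(j+1)})_r`. -/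
theorem omegaR_factor_of_ne_diamond (n : ℤ) (hn : 2 ≤ n) (ξ : ℤ → ℤ)
    (hξ : HeightFunction n ξ) (r : ℕ) (hr : 1 ≤ r) (i j : ℤ)
    (h1 : 1 ≤ i) (hij : i < j) (hj : j ≤ n)
    (hd : diamond n ξ i < j - 1) (hnd : j - 1 ≠ diamond n ξ (j - 1)) :
    omegaR ξ i j r = omegaR ξ i (bullet n ξ j + 1) r * Ypow j (ξ (j + 1)) r := by
  obtain ⟨d1, d2, d3⟩ := diamond_mem_aux n ξ i (by omega)
  have hjn : j ≠ n := by
    rintro rfl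
    apply hnd
    unfold diamond
    rw [if_neg (by omega), if_neg]
    rintro ⟨x, hx1, hx2, -⟩
    omega
  have hjn' : j - 1 ≤ n - 2 := by omega
  have hturn : ξ (j - 1) ≠ ξ (j + 1) := by
    intro h
    exact hnd ((diamond_fix_aux n ξ _ hjn').2 (by rw [h]; congr 1; ring))
  have hD1 := diamond_le_aux n ξ 1 (diamond n ξ i) (by omega) d2 d3
  have hdm : diamond n ξ i ∈
      ({l : ℤ | diamond n ξ 1 ≤ l ∧ l < j ∧ l = diamond n ξ l} : Set ℤ) :=
    ⟨hD1, by omega, (diamond_fix_aux n ξ _ d2).2 d3⟩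
  have hbdd : BddAbove ({l : ℤ | diamond n ξ 1 ≤ l ∧ l < j ∧ l = diamond n ξ l} : Set ℤ) :=
    ⟨j, fun x hx => hx.2.1.le⟩
  have hb : bullet n ξ j = sSup {l : ℤ | diamond n ξ 1 ≤ l ∧ l < j ∧ l = diamond n ξ l} := by
    unfold bullet
    rw [if_neg (by omega)]
  have hmem := Int.csSup_mem ⟨_, hdm⟩ hbdd
  have hmax := fun x hx => le_csSup (a := x) hbdd hx
  have hdb := hmax _ hdm
  rw [← hb] at hmem hmax hdb
  generalize bullet n ξ j = b at *
  obtain ⟨b1, b2, b3⟩ := hmem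
  have hbj : b ≠ j - 1 := by
    rintro rfl
    exact hnd b3
  have hbt := (diamond_fix_aux n ξ b (by omega)).1 b3
  have hlast : 2 * ξ j - ξ (j - 1) = ξ (j + 1) := by
    have e1 := hξ.1 j (by omega) hj
    have e2 := hξ.1 (j + 1) (by omega) (by omega)
    rw [add_sub_cancel_right] at e2
    rcases (abs_eq zero_le_one).1 e1 with e1 | e1 <;>
    rcases (abs_eq zero_le_one).1 e2 with e2 | e2 <;> omega
  have hset : (Finset.Ioo i j).filter (fun l => ξ (l - 1) = ξ (l + 1)) =
      insert (b + 1) ((Finset.Ioo i (b + 1)).filter (fun l => ξ (l - 1) = ξ (l + 1))) := by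
    ext l
    simp only [Finset.mem_filter, Finset.mem_Ioo, Finset.mem_insert]
    constructor
    · rintro ⟨⟨l1, l2⟩, l3⟩
      by_cases hl : l ≤ b + 1
      · by_cases hl' : l = b + 1
        · exact Or.inl hl'
        · exact Or.inr ⟨⟨l1, by omega⟩, l3⟩
      · exfalso
        have := hmax (l - 1) ⟨by omega, by omega,
          (diamond_fix_aux n ξ _ (by omega)).2 (by rw [l3]; congr 1; ring)⟩
        omega
    · rintro (rfl | ⟨⟨l1, l2⟩, l3⟩)
      · refine ⟨⟨by omega, by omega⟩, ?_⟩
        rw [add_sub_cancel_right, hbt]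
        congr 1
        ring
      · exact ⟨⟨l1, by omega⟩, l3⟩
  unfold omegaR
  rw [hset, Finset.prod_insert (by simp), hlast]
  congr 1
  rw [mul_assoc, mul_comm (Ypow (b + 1) _ r)]
end

section
/- Let ξ be a height function on [1,n] and let r ≥ 1. Define in 𝒫, for 1 ≤ l ≤ n: x_l := (Y_{l, ξ(l+1)})_r, f′_l := (Y_{l, ξ(l)+1})_{r−1}, f″_l := (Y_{l, ξ(l)−1})_{r+1}, with the conventions (Y_{i,a})_0 := 1 and x_{n+1} := 1. For 1 ≤ i ≤ j ≤ n define H(i,j) := (Y_{i, ξ(i)−ε_i})_r if j = i_⋄, where ε_i := ξ(i+1) − ξ(i) ∈ {±1}, and H(i,j) := (ω(i, j̄))_r if j ≠ i_⋄, where j̄ := j+1 if j ≠ j_⋄ and j̄ := j_• + 1 if j = j_⋄. Then: (a) x_i · H(i,i) = f′_i · f″_i · x_{i+1}^{1−d_i} for every 1 ≤ i ≤ n; and (b) x_j · H(i,j) = H(i,j−1) · (f′_j · f″_j)^{d_{j−1}} · x_{j+1}^{1−d_j} for every 1 ≤ i < j ≤ n. (These are the monomial identities underlying the computation of the highest l-weight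 monomials of the cluster variables x[α_{i,j}]: the right-hand sides are the dominant terms of the corresponding exchange relations.) -/
open scoped Classical

/-- `x_l := (Y_{l, ξ(l+1)})_r` for `1 ≤ l ≤ n`, with the convention `x_{n+1} := 1`. -/
noncomputable def xm (n : ℤ) (ξ : ℤ → ℤ) (r : ℕ) (l : ℤ) : P :=
  if 1 ≤ l ∧ l ≤ n then Ypow l (ξ (l + 1)) r else 1

/-- `f′_l := (Y_{l, ξ(l)+1})_{r−1}`. -/
noncomputable def fpm (ξ : ℤ → ℤ) (r : ℕ) (l : ℤ) : P := Ypow l (ξ l + 1) (r - 1)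

/-- `f″_l := (Y_{l, ξ(l)−1})_{r+1}`. -/
noncomputable def fppm (ξ : ℤ → ℤ) (r : ℕ) (l : ℤ) : P := Ypow l (ξ l - 1) (r + 1)

/-- `H(i,j) := (Y_{i, ξ(i)−ε_i})_r` if `j = i_⋄` (where `ε_i = ξ(i+1) − ξ(i)`), and
`H(i,j) := (ω(i, j̄))_r` otherwise, where `j̄ = j+1` if `j ≠ j_⋄` and `j̄ = j_•+1` if
`j = j_⋄`. -/
noncomputable def Hm (n : ℤ) (ξ : ℤ → ℤ) (r : ℕ) (i j : ℤ) : P :=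
  if j = diamond n ξ i then Ypow i (ξ i - (ξ (i + 1) - ξ i)) r
  else omegaR ξ i (if j = diamond n ξ j then bullet n ξ j + 1 else j + 1) r

/-- predicate equivalent to `l = l_⋄` -/
def Dp (n : ℤ) (ξ : ℤ → ℤ) (l : ℤ) : Prop := l = n ∨ ξ l = ξ (l + 2)

lemma diamond_spec (n : ℤ) (ξ : ℤ → ℤ) (hξ : HeightFunction n ξ) (i : ℤ) (hi : i ≤ n) :
    i ≤ diamond n ξ i ∧ diamond n ξ i ≤ n ∧ Dp n ξ (diamond n ξ i) ∧
      (∀ l, i ≤ l → l < diamond n ξ i → ¬ Dp n ξ l) := by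
  obtain ⟨-, -, h3⟩ := hξ
  unfold diamond
  split_ifs with h1 h2
  · subst h1
    exact ⟨le_rfl, le_rfl, Or.inl rfl, fun l _ _ => by omega⟩
  · have hb : BddBelow {l : ℤ | i ≤ l ∧ l ≤ n - 2 ∧ ξ l = ξ (l + 2)} := ⟨i, fun l hl => hl.1⟩
    have hm := Int.csInf_mem h2 hb
    refine ⟨hm.1, by have := hm.2.1; omega, Or.inr hm.2.2, ?_⟩
    intro l hl1 hl2 hD
    have h4 := hm.2.1
    rcases hD with hD | hD
    · omega
    · have := csInf_le hb (show l ∈ _ from ⟨hl1, by omega, hD⟩)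
      omega
  · refine ⟨by omega, by omega, Or.inr ?_, ?_⟩
    · rw [show n - 1 + 2 = n + 1 by ring, h3]
    · intro l hl1 hl2 hD
      rcases hD with hD | hD
      · omega
      · exact h2 ⟨l, hl1, by omega, hD⟩

lemma diamond_self (n : ℤ) (ξ : ℤ → ℤ) (hξ : HeightFunction n ξ) (i : ℤ) (hi : i ≤ n) :
    i = diamond n ξ i ↔ Dp n ξ i := by
  obtain ⟨h1, h2, h3, h4⟩ := diamond_spec n ξ hξ i hi
  constructor
  · intro h; rw [← h] at h3; exact h3
  · intro h
    by_contra hne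
    exact h4 i le_rfl (by omega) h

lemma bullet_spec (n : ℤ) (ξ : ℤ → ℤ) (hξ : HeightFunction n ξ) (hn : 2 ≤ n) (j : ℤ) (hj : j ≤ n)
    (hd : diamond n ξ 1 < j) :
    bullet n ξ j < j ∧ Dp n ξ (bullet n ξ j) ∧
      (∀ l, 1 ≤ l → bullet n ξ j < l → l < j → ¬ Dp n ξ l) := by
  obtain ⟨h1, h2, h3, h4⟩ := diamond_spec n ξ hξ 1 (by omega)
  unfold bullet
  rw [if_neg (by omega)]
  have hb : BddAbove {l : ℤ | diamond n ξ 1 ≤ l ∧ l < j ∧ l = diamond n ξ l} :=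
    ⟨j, fun l hl => hl.2.1.le⟩
  have hne : ({l : ℤ | diamond n ξ 1 ≤ l ∧ l < j ∧ l = diamond n ξ l}).Nonempty :=
    ⟨diamond n ξ 1, le_rfl, hd, (diamond_self n ξ hξ _ h2).2 h3⟩
  have hm := Int.csSup_mem hne hb
  refine ⟨hm.2.1, (diamond_self n ξ hξ _ (by have := hm.2.1; omega)).1 hm.2.2, ?_⟩
  intro l hl0 hl1 hl2 hD
  have h5 := hm.1
  have := le_csSup hb (show l ∈ _ from ⟨by omega, hl2, (diamond_self n ξ hξ _ (by omega)).2 hD⟩)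
  omega

lemma step (n : ℤ) (ξ : ℤ → ℤ) (hξ : HeightFunction n ξ) (i : ℤ) (h1 : 1 ≤ i) (h2 : i ≤ n)
    (hn : 2 ≤ n) : ξ (i + 1) = ξ i + 1 ∨ ξ (i + 1) = ξ i - 1 := by
  obtain ⟨h, -, h3⟩ := hξ
  by_cases hin : i = n
  · have := h n hn le_rfl
    rw [abs_eq (by norm_num)] at this
    subst hin
    omega
  · have := h (i + 1) (by omega) (by omega)
    rw [abs_eq (by norm_num), add_sub_cancel_right] at this
    omega

lemma ff_eq (l a b : ℤ) (r : ℕ) (hr : 1 ≤ r) (h : a = b + 1 ∨ a = b - 1) :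
    Ypow l (b + 1) (r - 1) * Ypow l (b - 1) (r + 1) = Ypow l a r * Ypow l (2 * b - a) r := by
  obtain ⟨s, rfl⟩ : ∃ s, r = s + 1 := ⟨r - 1, by omega⟩
  have key : Ypow l (b + 1) s * Ypow l (b - 1) (s + 1 + 1)
      = Ypow l (b + 1) (s + 1) * Ypow l (b - 1) (s + 1) := by
    unfold Ypow
    rw [Finset.prod_range_succ _ (s + 1), Finset.prod_range_succ (fun t : ℕ => Y l (b + 1 + 2 * (t : ℤ))) s]
    rw [show b - 1 + 2 * ((s + 1 : ℕ) : ℤ) = b + 1 + 2 * (s : ℤ) by push_cast; ring]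
    rw [mul_assoc, mul_comm (Y l _)]
  rw [Nat.add_sub_cancel, key]
  rcases h with rfl | rfl
  · rw [show 2 * b - (b + 1) = b - 1 by ring]
  · rw [show 2 * b - (b - 1) = b + 1 by ring, mul_comm]

noncomputable def Mm (ξ : ℤ → ℤ) (r : ℕ) (i j : ℤ) : P :=
  Ypow i (2 * ξ i - ξ (i + 1)) r *
    (∏ l ∈ (Finset.Ioc i j).filter (fun l => ξ (l - 1) = ξ (l + 1)),
      Ypow l (2 * ξ l - ξ (l - 1)) r)

lemma Dp_pred (n : ℤ) (ξ : ℤ → ℤ) (l : ℤ) (h : l ≤ n) :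
    Dp n ξ (l - 1) ↔ ξ (l - 1) = ξ (l + 1) := by
  unfold Dp
  rw [show l - 1 + 2 = l + 1 by ring]
  constructor
  · rintro (h | h)
    · omega
    · exact h
  · exact Or.inr

lemma dd_pos (n : ℤ) (ξ : ℤ → ℤ) (hξ : HeightFunction n ξ) (i : ℤ) (h1 : 1 ≤ i) (hi : i ≤ n)
    (h : Dp n ξ i) : dd n ξ i = 1 := if_pos ⟨h1, (diamond_self n ξ hξ i hi).2 h⟩

lemma dd_neg (n : ℤ) (ξ : ℤ → ℤ) (hξ : HeightFunction n ξ) (i : ℤ) (hi : i ≤ n)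
    (h : ¬ Dp n ξ i) : dd n ξ i = 0 := if_neg fun h' => h ((diamond_self n ξ hξ i hi).1 h'.2)

lemma H_eq (n : ℤ) (hn : 2 ≤ n) (ξ : ℤ → ℤ) (hξ : HeightFunction n ξ) (r : ℕ) (i j : ℤ)
    (h1 : 1 ≤ i) (hij : i ≤ j) (hj : j ≤ n) :
    Hm n ξ r i j = Mm ξ r i j * xm n ξ r (j + 1) ^ (1 - dd n ξ j) := by
  obtain ⟨d1, d2, d3, d4⟩ := diamond_spec n ξ hξ i (by omega)
  unfold Hm
  split_ifs with c1 c2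
  · rw [dd_pos n ξ hξ j (by omega) hj (c1 ▸ d3), sub_self, zpow_zero, mul_one, Mm,
      Finset.filter_false_of_mem, Finset.prod_empty, mul_one]
    · congr 1; ring
    · intro l hl hl2
      rw [Finset.mem_Ioc] at hl
      exact d4 (l - 1) (by omega) (by omega) ((Dp_pred n ξ l (by omega)).2 hl2)
  · have hD := (diamond_self n ξ hξ j hj).1 c2
    obtain ⟨e1, e2, e3, e4⟩ := diamond_spec n ξ hξ 1 (by omega)
    have hlt : diamond n ξ i < j := by
      by_contra hc
      exact d4 j hij (by omega) hD
    have hlt1 : diamond n ξ 1 ≤ diamond n ξ i := by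
      by_contra hc
      exact e4 _ (by omega) (by omega) d3
    obtain ⟨b1, b2, b3⟩ := bullet_spec n ξ hξ hn j hj (by omega)
    have hbi : diamond n ξ i ≤ bullet n ξ j := by
      by_contra hc
      exact b3 _ (by omega) (by omega) hlt d3
    generalize bullet n ξ j = b at *
    rw [dd_pos n ξ hξ j (by omega) hj hD, sub_self, zpow_zero, mul_one, Mm, omegaR]
    have hs : (Finset.Ioc i j).filter (fun l => ξ (l - 1) = ξ (l + 1)) =
        insert (b + 1) ((Finset.Ioo i (b + 1)).filter (fun l => ξ (l - 1) = ξ (l + 1))) := by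
      ext l
      simp only [Finset.mem_filter, Finset.mem_Ioc, Finset.mem_insert, Finset.mem_Ioo]
      constructor
      · rintro ⟨⟨p, q⟩, s⟩
        by_cases hl : l ≤ b + 1
        · by_cases hl2 : l = b + 1
          · exact Or.inl hl2
          · exact Or.inr ⟨⟨p, by omega⟩, s⟩
        · exact absurd ((Dp_pred n ξ l (by omega)).2 s) (b3 _ (by omega) (by omega) (by omega))
      · rintro (rfl | ⟨⟨p, q⟩, s⟩)
        · refine ⟨⟨by omega, by omega⟩, (Dp_pred n ξ _ (by omega)).1 ?_⟩
          rwa [add_sub_cancel_right]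
        · exact ⟨⟨p, by omega⟩, s⟩
    rw [hs, Finset.prod_insert (by simp), mul_assoc]
    congr 1
    rw [mul_comm]
  · have hD : ¬ Dp n ξ j := fun h => c2 ((diamond_self n ξ hξ j hj).2 h)
    have hjn : j ≠ n := fun h => hD (Or.inl h)
    have hx : ξ (j + 1 + 1) = 2 * ξ (j + 1) - ξ j := by
      have s1 := step n ξ hξ j (by omega) hj hn
      have s2 := step n ξ hξ (j + 1) (by omega) (by omega) hn
      have s3 : ξ j ≠ ξ (j + 1 + 1) := fun h => hD (Or.inr (by rw [h]; congr 1; ring))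
      omega
    have hI : Finset.Ioo i (j + 1) = Finset.Ioc i j := by
      ext l; simp only [Finset.mem_Ioo, Finset.mem_Ioc]; omega
    rw [dd_neg n ξ hξ j hj hD, sub_zero, zpow_one, Mm, omegaR, hI, xm, if_pos ⟨by omega, by omega⟩,
      hx, add_sub_cancel_right]

/-- The monomial identities underlying the computation of the highest
`l`-weight monomials of the cluster variables `x[α_{i,j}]`:
(a) `x_i ⬝ H(i,i) = f′_i ⬝ f″_i ⬝ x_{i+1}^{1−d_i}` for `1 ≤ i ≤ n`;
(b) `x_j ⬝ H(i,j) = H(i,j−1) ⬝ (f′_j f″_j)^{d_{j−1}} ⬝ x_{j+1}^{1−d_j}` for `1 ≤ i < j ≤ n`. -/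
theorem HLr_monomial_identities (n : ℤ) (hn : 2 ≤ n) (ξ : ℤ → ℤ)
    (hξ : HeightFunction n ξ) (r : ℕ) (hr : 1 ≤ r) :
    (∀ i : ℤ, 1 ≤ i → i ≤ n →
      xm n ξ r i * Hm n ξ r i i =
        fpm ξ r i * fppm ξ r i * xm n ξ r (i + 1) ^ (1 - dd n ξ i)) ∧
    (∀ i j : ℤ, 1 ≤ i → i < j → j ≤ n →
      xm n ξ r j * Hm n ξ r i j =
        Hm n ξ r i (j - 1) * (fpm ξ r j * fppm ξ r j) ^ (dd n ξ (j - 1)) *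
          xm n ξ r (j + 1) ^ (1 - dd n ξ j)) := by
  have hff : ∀ i, 1 ≤ i → i ≤ n →
      fpm ξ r i * fppm ξ r i = xm n ξ r i * Ypow i (2 * ξ i - ξ (i + 1)) r := by
    intro i h1 h2
    rw [fpm, fppm, xm, if_pos ⟨h1, h2⟩]
    exact ff_eq i _ _ r hr (step n ξ hξ i h1 h2 hn)
  refine ⟨fun i h1 h2 => ?_, fun i j h1 hij hj => ?_⟩
  · rw [H_eq n hn ξ hξ r i i h1 le_rfl h2, hff i h1 h2, Mm]
    simp [mul_assoc]
  · rw [H_eq n hn ξ hξ r i j h1 hij.le hj, H_eq n hn ξ hξ r i (j - 1) h1 (by omega) (by omega),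
      ← mul_assoc]
    congr 1
    rw [sub_add_cancel, hff j (by omega) hj]
    have hI : Finset.Ioc i j = insert j (Finset.Ioc i (j - 1)) := by
      ext l; simp only [Finset.mem_insert, Finset.mem_Ioc]; omega
    by_cases hD : Dp n ξ (j - 1)
    · have hD' := (Dp_pred n ξ j hj).1 hD
      rw [dd_pos n ξ hξ (j - 1) (by omega) (by omega) hD, Mm, Mm, hI, Finset.filter_insert,
        if_pos hD', Finset.prod_insert (by simp), sub_self, zpow_zero, zpow_one, mul_one, hD']
      simp only [mul_comm, mul_left_comm, mul_assoc]
    · have hD' : ¬ ξ (j - 1) = ξ (j + 1) := fun h => hD ((Dp_pred n ξ j hj).2 h)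
      rw [dd_neg n ξ hξ (j - 1) (by omega) hD, Mm, Mm, hI, Finset.filter_insert,
        if_neg hD', sub_zero, zpow_zero, zpow_one, mul_one, mul_comm]
end

section
/- Let k ≥ 2, let 1 ≤ i_1 < i_2 < ⋯ < i_k be integers, and let a_1, …, a_k ∈ ℤ satisfy (a_j − a_{j−1})(a_{j+1} − a_j) < 0 for 2 ≤ j ≤ k−1 and |a_j − a_{j−1}| = i_j − i_{j−1} + 2 for 2 ≤ j ≤ k. Then there exist an integer n ≥ i_k + 2 and a height function ξ on [1,n] such that: ξ(i_s − 1) = ξ(i_s + 1) for every 2 ≤ s ≤ k−1; (i_k)_⋄ = i_k; (i_k)_• = i_k − 1; i_k ≠ (i_1)_⋄; and ω(i_1, i_k) = Y_{i_1,a_1} Y_{i_2,a_2} ⋯ Y_{i_k,a_k}. Consequently (ω(i_1, i_k))_r = (Y_{i_1,a_1} Y_{i_2,a_2} ⋯ Y_{i_k,a_k})_r for every r ≥ 1. -/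
open scoped Classical

lemma aux_strict (k : ℕ) (ι : ℕ → ℤ) (hmono : ∀ s, 1 ≤ s → s < k → ι s < ι (s + 1)) :
    ∀ s t, 1 ≤ s → s < t → t ≤ k → ι s < ι t := by
  intro s t hs hst
  induction t, hst using Nat.le_induction with
  | base => intro h; exact hmono s hs (by omega)
  | succ t ht ih => intro h; exact (ih (by omega)).trans (hmono t (by omega) (by omega))

lemma aux_locate (k : ℕ) (ι : ℕ → ℤ) (hk : 1 ≤ k) :
    ∀ x, ι 1 < x → x ≤ ι k → ∃ s, 1 ≤ s ∧ s < k ∧ ι s < x ∧ x ≤ ι (s + 1) := by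
  induction k, hk using Nat.le_induction with
  | base => intro x h1 h2; omega
  | succ k hk ih =>
    intro x h1 h2
    by_cases h : x ≤ ι k
    · obtain ⟨s, a1, a2, a3, a4⟩ := ih x h1 h
      exact ⟨s, a1, by omega, a3, a4⟩
    · exact ⟨k, hk, by omega, by omega, h2⟩

lemma aux_f (k : ℕ) (hk : 2 ≤ k) (ι a ε : ℕ → ℤ)
    (hmono : ∀ s, 1 ≤ s → s < k → ι s < ι (s + 1))
    (hε : ∀ s, 1 ≤ s → s < k → a (s + 1) - a s = ε s * (ι (s + 1) - ι s + 2))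
    (halt : ∀ s, 1 ≤ s → s + 1 < k → ε (s + 1) = - ε s) :
    ∃ f : ℤ → ℤ, (∀ x, x ≤ ι 1 → f x = a 1 + ε 1 * (x - ι 1 + 1)) ∧
      ∀ s, 1 ≤ s → s < k → ∀ x, ι s ≤ x → x ≤ ι (s + 1) → f x = a s + ε s * (x - ι s + 1) := by
  induction k, hk using Nat.le_induction with
  | base =>
    refine ⟨fun x => a 1 + ε 1 * (x - ι 1 + 1), fun _ _ => rfl, ?_⟩
    intro s h1 h2 x _ _
    obtain rfl : s = 1 := by omega
    rfl
  | succ k hk ih =>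
    obtain ⟨f, hf1, hf⟩ := ih (fun s h1 h2 => hmono s h1 (by omega))
      (fun s h1 h2 => hε s h1 (by omega)) (fun s h1 h2 => halt s h1 (by omega))
    have hst := aux_strict (k + 1) ι hmono
    refine ⟨fun x => if x ≤ ι k then f x else a k + ε k * (x - ι k + 1), ?_, ?_⟩
    · intro x hx
      have := hst 1 k le_rfl (by omega) (by omega)
      simp only [if_pos (show x ≤ ι k by omega)]
      exact hf1 x hx
    · intro s h1 h2 x hx1 hx2
      rcases Nat.lt_or_ge s k with h | h
      · have : ι (s + 1) ≤ ι k := by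
          rcases Nat.lt_or_ge (s + 1) k with h' | h'
          · exact (hst _ _ (by omega) h' (by omega)).le
          · rw [show s + 1 = k by omega]
        simp only [if_pos (show x ≤ ι k by omega)]
        exact hf s h1 h x hx1 hx2
      · obtain rfl : s = k := by omega
        by_cases hx : x ≤ ι s
        · obtain rfl : x = ι s := by omega
          simp only [le_refl, if_true]
          obtain ⟨t, rfl⟩ : ∃ t, s = t + 1 := ⟨s - 1, by omega⟩
          rw [hf t (by omega) (by omega) _ (hmono t (by omega) (by omega)).le le_rfl]
          have e1 := hε t (by omega) (by omega)
          have e2 := halt t (by omega) (by omega)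
          rw [e2]; linear_combination -e1
        · simp only [if_neg hx]

lemma aux_diamond_self (n : ℤ) (ξ : ℤ → ℤ) (i : ℤ) (h1 : i ≤ n - 2) (h : ξ i = ξ (i + 2)) :
    diamond n ξ i = i := by
  have hm : i ∈ ({l : ℤ | i ≤ l ∧ l ≤ n - 2 ∧ ξ l = ξ (l + 2)} : Set ℤ) := ⟨le_rfl, h1, h⟩
  unfold diamond
  rw [if_neg (by omega), if_pos ⟨i, hm⟩]
  exact IsLeast.csInf_eq ⟨hm, fun x hx => hx.1⟩

lemma aux_diamond_le (n : ℤ) (ξ : ℤ → ℤ) (i j : ℤ) (hij : i ≤ j) (h1 : j ≤ n - 2)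
    (h : ξ j = ξ (j + 2)) : diamond n ξ i ≤ j := by
  have hm : j ∈ ({l : ℤ | i ≤ l ∧ l ≤ n - 2 ∧ ξ l = ξ (l + 2)} : Set ℤ) := ⟨hij, h1, h⟩
  unfold diamond
  rw [if_neg (by omega), if_pos ⟨j, hm⟩]
  exact csInf_le ⟨i, fun x hx => hx.1⟩ hm

/-- Given data `i₁ < ⋯ < i_k`, `a₁, …, a_k` satisfying the zig-zag conditions
of an HL-monomial, there is a height function `ξ` (for suitable `n ≥ i_k + 2`) realizing
`Y_{i₁,a₁} ⋯ Y_{i_k,a_k}` as `ω(i₁, i_k)`, with `(i_k)_⋄ = i_k`, `(i_k)_• = i_k − 1`,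
`i_k ≠ (i₁)_⋄`, and `ξ(i_s − 1) = ξ(i_s + 1)` for `2 ≤ s ≤ k−1`; consequently
`(ω(i₁,i_k))_r = (Y_{i₁,a₁} ⋯ Y_{i_k,a_k})_r` for every `r ≥ 1`. -/
theorem exists_heightFunction_realizing_HL_monomial (k : ℕ) (hk : 2 ≤ k)
    (ι a : ℕ → ℤ) (hι1 : 1 ≤ ι 1)
    (hmono : ∀ s, 1 ≤ s → s < k → ι s < ι (s + 1))
    (hsign : ∀ s, 2 ≤ s → s ≤ k - 1 → (a s - a (s - 1)) * (a (s + 1) - a s) < 0)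
    (habs : ∀ s, 2 ≤ s → s ≤ k → |a s - a (s - 1)| = ι s - ι (s - 1) + 2) :
    ∃ (n : ℤ) (ξ : ℤ → ℤ), 2 ≤ n ∧ ι k + 2 ≤ n ∧ HeightFunction n ξ ∧
      (∀ s, 2 ≤ s → s ≤ k - 1 → ξ (ι s - 1) = ξ (ι s + 1)) ∧
      diamond n ξ (ι k) = ι k ∧
      bullet n ξ (ι k) = ι k - 1 ∧
      ι k ≠ diamond n ξ (ι 1) ∧
      omegaR ξ (ι 1) (ι k) 1 = ∏ s ∈ Finset.Icc 1 k, Y (ι s) (a s) ∧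
      (∀ r : ℕ, 1 ≤ r →
        omegaR ξ (ι 1) (ι k) r = ∏ s ∈ Finset.Icc 1 k, Ypow (ι s) (a s) r) := by
  have hst := aux_strict k ι hmono
  obtain ⟨ε, hε1, hε, halt⟩ : ∃ ε : ℕ → ℤ, (∀ s, ε s = 1 ∨ ε s = -1) ∧
      (∀ s, 1 ≤ s → s < k → a (s + 1) - a s = ε s * (ι (s + 1) - ι s + 2)) ∧
      (∀ s, 1 ≤ s → s + 1 < k → ε (s + 1) = - ε s) := by
    refine ⟨fun s => if a s < a (s + 1) then 1 else -1, ?_, ?_, ?_⟩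
    · intro s; by_cases h : a s < a (s + 1) <;> simp [h]
    · intro s h1 h2
      have e := habs (s + 1) (by omega) (by omega)
      simp only [Nat.add_sub_cancel] at e
      by_cases h : a s < a (s + 1)
      · rw [abs_of_pos (by omega)] at e
        simp only [if_pos h]; omega
      · rw [abs_of_nonpos (by omega)] at e
        simp only [if_neg h]; omega
    · intro s h1 h2
      have e := hsign (s + 1) (by omega) (by omega)
      simp only [Nat.add_sub_cancel] at e
      rcases mul_neg_iff.1 e with ⟨e1, e2⟩ | ⟨e1, e2⟩
      · simp only [if_pos (show a s < a (s + 1) by omega),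
          if_neg (show ¬ a (s + 1) < a (s + 1 + 1) by omega)]
      · simp only [if_neg (show ¬ a s < a (s + 1) by omega),
          if_pos (show a (s + 1) < a (s + 1 + 1) by omega)]; rfl
  obtain ⟨f, hf1, hf⟩ := aux_f k hk ι a ε hmono hε halt
  have hloc := aux_locate k ι (by omega)
  have h1k := hst 1 k le_rfl (by omega) le_rfl
  have S1 : ∀ s, 1 ≤ s → s < k → ∀ x, ι s < x → x ≤ ι (s + 1) → f x = f (x - 1) + ε s := by
    intro s h1 h2 x hx1 hx2
    rw [hf s h1 h2 x (by omega) hx2, hf s h1 h2 (x - 1) (by omega) (by omega)]; ring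
  have A1 : ∀ s, 1 ≤ s → s < k → f (ι s) = a s + ε s := by
    intro s h1 h2
    rw [hf s h1 h2 (ι s) le_rfl (hmono s h1 h2).le]; ring
  have A2 : ∀ s, 1 ≤ s → s < k → f (ι (s + 1)) = a (s + 1) - ε s := by
    intro s h1 h2
    rw [hf s h1 h2 (ι (s + 1)) (hmono s h1 h2).le le_rfl]
    linear_combination - hε s h1 h2
  have hstep : ∀ x, x ≤ ι k → |f x - f (x - 1)| = 1 := by
    intro x hx
    have : ∃ s, f x - f (x - 1) = ε s := by
      by_cases h : x ≤ ι 1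
      · refine ⟨1, ?_⟩
        rw [hf1 x h, hf1 (x - 1) (by omega)]; ring
      · obtain ⟨s, b1, b2, b3, b4⟩ := hloc x (by omega) hx
        exact ⟨s, by rw [S1 s b1 b2 x b3 b4]; ring⟩
    obtain ⟨s, hs⟩ := this
    rw [hs]
    rcases hε1 s with h | h <;> rw [h] <;> rfl
  obtain ⟨ξ, X0, X1, X2, X3, X4⟩ : ∃ ξ : ℤ → ℤ, ξ 0 = f 2 ∧ (∀ x, 1 ≤ x → x ≤ ι k → ξ x = f x) ∧
      ξ (ι k + 1) = f (ι k - 1) ∧ ξ (ι k + 2) = f (ι k) ∧ ξ (ι k + 3) = f (ι k - 1) := by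
    refine ⟨fun x => if x = 0 then f 2 else if x ≤ ι k then f x else
      if x = ι k + 2 then f (ι k) else f (ι k - 1), ?_, ?_, ?_, ?_, ?_⟩
    · simp
    · intro x h1 h2
      simp only [if_neg (show x ≠ 0 by omega), if_pos h2]
    · simp only [if_neg (show ι k + 1 ≠ 0 by omega), if_neg (show ¬ ι k + 1 ≤ ι k by omega),
        if_neg (show ι k + 1 ≠ ι k + 2 by omega)]
    · simp only [if_neg (show ι k + 2 ≠ 0 by omega), if_neg (show ¬ ι k + 2 ≤ ι k by omega),
        if_true]
    · simp only [if_neg (show ι k + 3 ≠ 0 by omega), if_neg (show ¬ ι k + 3 ≤ ι k by omega),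
        if_neg (show ι k + 3 ≠ ι k + 2 by omega)]
  have turn : ∀ s, 2 ≤ s → s ≤ k - 1 → ξ (ι s - 1) = ξ (ι s + 1) := by
    intro s h1 h2
    obtain ⟨t, rfl⟩ : ∃ t, s = t + 1 := ⟨s - 1, by omega⟩
    have b1 := hst 1 (t + 1) le_rfl (by omega) (by omega)
    have b2 := hst (t + 1) k (by omega) (by omega) le_rfl
    have b3 := hmono (t + 1) (by omega) (by omega)
    rw [X1 _ (by omega) (by omega), X1 _ (by omega) (by omega)]
    have c1 := S1 t (by omega) (by omega) (ι (t + 1)) (hmono t (by omega) (by omega)) le_rfl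
    have c2 := S1 (t + 1) (by omega) (by omega) (ι (t + 1) + 1) (by omega) (by omega)
    have c3 := halt t (by omega) (by omega)
    rw [add_sub_cancel_right] at c2
    omega
  have D1 : ξ (ι k) = ξ (ι k + 2) := by rw [X3, X1 _ (by omega) le_rfl]
  have D2 : ξ (ι k - 1) = ξ (ι k - 1 + 2) := by
    rw [show ι k - 1 + 2 = ι k + 1 by ring, X2, X1 _ (by omega) (by omega)]
  have main : ∀ r : ℕ, omegaR ξ (ι 1) (ι k) r = ∏ s ∈ Finset.Icc 1 k, Ypow (ι s) (a s) r := by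
    intro r
    have hsplit : Finset.Icc 1 k = insert 1 (insert k (Finset.Ioo 1 k)) := by
      ext s; simp only [Finset.mem_Icc, Finset.mem_insert, Finset.mem_Ioo]; omega
    rw [hsplit, Finset.prod_insert (by simp; omega), Finset.prod_insert (by simp)]
    have hmid : ∏ l ∈ (Finset.Ioo (ι 1) (ι k)).filter (fun l => ξ (l - 1) = ξ (l + 1)),
        Ypow l (2 * ξ l - ξ (l - 1)) r = ∏ s ∈ Finset.Ioo 1 k, Ypow (ι s) (a s) r := by
      symm
      apply Finset.prod_nbij ι
      · intro s hs
        rw [Finset.mem_Ioo] at hs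
        rw [Finset.mem_filter, Finset.mem_Ioo]
        exact ⟨⟨hst 1 s le_rfl hs.1 (by omega), hst s k (by omega) hs.2 le_rfl⟩,
          turn s (by omega) (by omega)⟩
      · intro s hs t ht hst'
        simp only [Finset.coe_Ioo, Set.mem_Ioo] at hs ht
        rcases lt_trichotomy s t with h | h | h
        · have := hst s t (by omega) h (by omega); omega
        · exact h
        · have := hst t s (by omega) h (by omega); omega
      · intro l hl
        simp only [Finset.coe_filter, Finset.mem_Ioo, Set.mem_ofPred_eq] at hl
        obtain ⟨⟨h1, h2⟩, h3⟩ := hl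
        rw [X1 _ (by omega) (by omega), X1 _ (by omega) (by omega)] at h3
        obtain ⟨s, b1, b2, b3, b4⟩ := hloc l h1 h2.le
        have hl : l = ι (s + 1) := by
          by_contra hne
          have c1 := S1 s b1 b2 l b3 b4
          have c2 := S1 s b1 b2 (l + 1) (by omega) (by omega)
          rw [add_sub_cancel_right] at c2
          have := hε1 s
          omega
        have : s + 1 ≠ k := by rintro rfl; omega
        refine ⟨s + 1, ?_, hl.symm⟩
        simp only [Finset.coe_Ioo, Set.mem_Ioo]; omega
      · intro s hs
        rw [Finset.mem_Ioo] at hs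
        obtain ⟨t, rfl⟩ : ∃ t, s = t + 1 := ⟨s - 1, by omega⟩
        have b1 := hst 1 (t + 1) le_rfl (by omega) (by omega)
        have b2 := hst (t + 1) k (by omega) (by omega) le_rfl
        have c1 := S1 t (by omega) (by omega) (ι (t + 1)) (hmono t (by omega) (by omega)) le_rfl
        have c2 := A2 t (by omega) (by omega)
        congr 1
        rw [X1 _ (by omega) (by omega), X1 _ (by omega) (by omega)]
        omega
    have hfirst : 2 * ξ (ι 1) - ξ (ι 1 + 1) = a 1 := by
      have b := hmono 1 le_rfl (by omega)
      have c1 := S1 1 le_rfl (by omega) (ι 1 + 1) (by omega) (by omega)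
      have c2 := A1 1 le_rfl (by omega)
      rw [add_sub_cancel_right] at c1
      rw [X1 _ (by omega) (by omega), X1 _ (by omega) (by omega)]
      omega
    have hlast : 2 * ξ (ι k) - ξ (ι k - 1) = a k := by
      rw [X1 _ (by omega) (by omega), X1 _ (by omega) (by omega)]
      obtain ⟨t, rfl⟩ : ∃ t, k = t + 1 := ⟨k - 1, by omega⟩
      have c1 := S1 t (by omega) (by omega) (ι (t + 1)) (hmono t (by omega) (by omega)) le_rfl
      have c2 := A2 t (by omega) (by omega)
      omega
    unfold omegaR
    rw [hfirst, hlast, mul_assoc, mul_comm (Ypow (ι k) (a k) r)]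
    congr 2
  have B1 : diamond (ι k + 2) ξ (ι k - 1) = ι k - 1 := aux_diamond_self _ _ _ (by omega) D2
  have B2 : diamond (ι k + 2) ξ 1 ≤ ι k - 1 := aux_diamond_le _ _ _ _ (by omega) (by omega) D2
  refine ⟨ι k + 2, ξ, by omega, le_rfl, ⟨?_, ?_, ?_⟩, turn, aux_diamond_self _ _ _ (by omega) D1,
    ?_, ?_, ?_, fun r _ => main r⟩
  · intro i h1 h2
    rcases lt_or_ge (ι k) i with h | h
    · have e := hstep (ι k) le_rfl
      rcases (show i = ι k + 1 ∨ i = ι k + 2 by omega) with rfl | rfl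
      · rw [add_sub_cancel_right, X2, X1 _ (by omega) le_rfl, abs_sub_comm]; exact e
      · rw [show ι k + 2 - 1 = ι k + 1 by ring, X2, X3]; exact e
    · rw [X1 _ (by omega) h, X1 _ (by omega) (by omega)]; exact hstep i h
  · rw [X0, X1 2 (by omega) (by omega)]
  · rw [show ι k + 2 + 1 = ι k + 3 by ring, show ι k + 2 - 1 = ι k + 1 by ring, X4, X2]
  · unfold bullet
    rw [if_neg (by omega)]
    refine IsGreatest.csSup_eq ⟨⟨B2, by omega, B1.symm⟩, fun x hx => ?_⟩
    have := hx.2.1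
    omega
  · have := aux_diamond_le (ι k + 2) ξ (ι 1) (ι k - 1) (by omega) (by omega) D2
    omega
  · rw [main 1]
    refine Finset.prod_congr rfl fun s _ => ?_
    simp [Ypow]
end
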